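/- arXiv:2309.08063 — 4 statements merged into one kernel-verified Lean document; each statement's English description precedes it below -/
import Mathlib

section
/- If the random vector (X, X̃^(1),…,X̃^(M)) with values in 𝒳^{M+1} is exchangeable, then for any measurable statistic T : 𝒳 → ℝ and any α ∈ [0,1], P(pval_T(X, X̃^(1),…,X̃^(M)) ≤ α) ≤ α. -/
open MeasureTheory
open scoped ENNReal Classical

noncomputable section

namespace ACSS

/-- The aCSS p-value `pval_T(X, X̃⁽¹⁾, …, X̃⁽ᴹ⁾)`. -/
def pval {𝒳 : Type*} (T : 𝒳 → ℝ) {M : ℕ} (x : 𝒳) (xt : Fin M → 𝒳) : ℝ :=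
  (1 + (Finset.univ.filter fun m : Fin M => T x ≤ T (xt m)).card) / (M + 1)

/-- A law on `Fin k → 𝒳` is exchangeable if it is invariant under all coordinate
permutations. -/
def IsExchangeable {𝒳 : Type*} [MeasurableSpace 𝒳] {k : ℕ} (μ : Measure (Fin k → 𝒳)) : Prop :=
  ∀ π : Equiv.Perm (Fin k), μ.map (· ∘ π) = μ

/-- number of coordinates whose statistic is at least that of coordinate `i` -/
def rk {𝒳 : Type*} (T : 𝒳 → ℝ) {n : ℕ} (y : Fin n → 𝒳) (i : Fin n) : ℝ :=
  ((Finset.univ.filter fun j : Fin n => T (y i) ≤ T (y j)).card : ℝ)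

theorem count_le {𝒳 : Type*} (T : 𝒳 → ℝ) {n : ℕ} (y : Fin n → 𝒳) (c : ℝ) (hc : 0 ≤ c) :
    ((Finset.univ.filter fun i : Fin n => rk T y i ≤ c).card : ℝ) ≤ c := by
  rcases (Finset.univ.filter fun i : Fin n => rk T y i ≤ c).eq_empty_or_nonempty with h | h
  · rw [h]; simpa using hc
  · obtain ⟨i, hi, hmin⟩ := Finset.exists_min_image _ (fun i => T (y i)) h
    refine le_trans ?_ (Finset.mem_filter.1 hi).2
    unfold rk
    exact_mod_cast Finset.card_le_card fun j hj =>
      Finset.mem_filter.2 ⟨Finset.mem_univ _, hmin j hj⟩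

theorem measurable_rk {𝒳 : Type*} [MeasurableSpace 𝒳] (T : 𝒳 → ℝ) (hT : Measurable T) {n : ℕ}
    (i : Fin n) : Measurable fun y : Fin n → 𝒳 => rk T y i := by
  have : (fun y : Fin n → 𝒳 => rk T y i) =
      fun y => ∑ j : Fin n, if T (y i) ≤ T (y j) then (1 : ℝ) else 0 := by
    funext y
    simp [rk]
  rw [this]
  refine Finset.measurable_sum _ fun j _ => Measurable.ite ?_ measurable_const measurable_const
  exact measurableSet_le (hT.comp (measurable_pi_apply i)) (hT.comp (measurable_pi_apply j))

theorem rk_comp {𝒳 : Type*} (T : 𝒳 → ℝ) {n : ℕ} (y : Fin n → 𝒳) (π : Equiv.Perm (Fin n))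
    (i : Fin n) : rk T (y ∘ π) i = rk T y (π i) := by
  unfold rk
  norm_cast
  refine Finset.card_bij (fun j _ => π j) ?_ ?_ ?_
  · intro j hj; simpa using hj
  · intro a _ b _ hab; exact π.injective hab
  · intro b hb; exact ⟨π.symm b, by simpa using hb, by simp⟩

theorem pval_eq {𝒳 : Type*} (T : 𝒳 → ℝ) {M : ℕ} (x : 𝒳) (xt : Fin M → 𝒳) :
    pval T x xt = rk T (Fin.cons x xt : Fin (M + 1) → 𝒳) 0 / (M + 1) := by
  unfold pval rk
  rw [Fin.card_filter_univ_succ]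
  simp [add_comm]

theorem exch_bound {𝒳 : Type*} [MeasurableSpace 𝒳] {n : ℕ} (μ : Measure (Fin n → 𝒳))
    [IsProbabilityMeasure μ] (h : IsExchangeable μ) (T : 𝒳 → ℝ) (hT : Measurable T)
    (c : ℝ) (hc : 0 ≤ c) (i₀ : Fin n) :
    n * μ {y | rk T y i₀ ≤ c} ≤ ENNReal.ofReal c := by
  have hm : ∀ i : Fin n, MeasurableSet {y : Fin n → 𝒳 | rk T y i ≤ c} := fun i =>
    measurableSet_le (measurable_rk T hT i) measurable_const
  have he : ∀ i, μ {y | rk T y i ≤ c} = μ {y | rk T y i₀ ≤ c} := by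
    intro i
    conv_rhs => rw [← h (Equiv.swap i₀ i)]
    rw [Measure.map_apply (by fun_prop) (hm i₀)]
    congr 1
    ext y
    simp [rk_comp]
  calc (n : ℝ≥0∞) * μ {y | rk T y i₀ ≤ c} = ∑ i : Fin n, μ {y | rk T y i ≤ c} := by
        simp [he]
    _ = ∑ i : Fin n, ∫⁻ y, Set.indicator {y | rk T y i ≤ c} 1 y ∂μ := by
        simp [lintegral_indicator_one, hm]
    _ = ∫⁻ y, ∑ i : Fin n, Set.indicator {y | rk T y i ≤ c} 1 y ∂μ := by
        rw [lintegral_finsetSum]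
        intro i _
        exact measurable_one.indicator (hm i)
    _ ≤ ∫⁻ _, ENNReal.ofReal c ∂μ := by
        refine lintegral_mono fun y => ?_
        have := ENNReal.ofReal_le_ofReal (count_le T y c hc)
        rw [ENNReal.ofReal_natCast] at this
        simpa [Set.indicator_apply] using this
    _ = ENNReal.ofReal c := by simp

/-- If `(X, X̃⁽¹⁾, …, X̃⁽ᴹ⁾)` is exchangeable, then the p-value is valid:
`P(pval_T ≤ α) ≤ α` for every measurable statistic `T` and every `α ∈ [0,1]`. -/
theorem pval_valid_of_exchangeable
    {𝒳 : Type*} [MeasurableSpace 𝒳] {M : ℕ}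
    {Ω : Type*} [MeasurableSpace Ω] (P : Measure Ω) [IsProbabilityMeasure P]
    (X : Ω → 𝒳) (Xt : Fin M → Ω → 𝒳)
    (hX : Measurable X) (hXt : ∀ m, Measurable (Xt m))
    (hexch : IsExchangeable
      (P.map fun ω => (Fin.cons (X ω) fun m => Xt m ω : Fin (M + 1) → 𝒳)))
    (T : 𝒳 → ℝ) (hT : Measurable T) (α : ℝ) (hα : α ∈ Set.Icc (0 : ℝ) 1) :
    P {ω | pval T (X ω) (fun m => Xt m ω) ≤ α} ≤ ENNReal.ofReal α := by
  have hY : Measurable fun ω => (Fin.cons (X ω) fun m => Xt m ω : Fin (M + 1) → 𝒳) := by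
    refine measurable_pi_lambda _ fun i => ?_
    refine Fin.cases ?_ (fun m => ?_) i
    · simpa using hX
    · simpa using hXt m
  have := Measure.isProbabilityMeasure_map (μ := P) hY.aemeasurable
  have hpos : (0 : ℝ) < M + 1 := by positivity
  have key := exch_bound _ hexch T hT (α * (M + 1)) (mul_nonneg hα.1 hpos.le) 0
  rw [Measure.map_apply hY (measurableSet_le (measurable_rk T hT 0) measurable_const),
    mul_comm α, ENNReal.ofReal_mul hpos.le] at key
  have e : ENNReal.ofReal ((M : ℝ) + 1) = ((M + 1 : ℕ) : ℝ≥0∞) := by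
    rw [← ENNReal.ofReal_natCast]; push_cast; rfl
  rw [e, ENNReal.mul_le_mul_iff_right (by simp) (by exact ENNReal.natCast_ne_top _)] at key
  refine le_trans (measure_mono fun ω hω => ?_) key
  simp only [Set.mem_setOf_eq, pval_eq, div_le_iff₀ hpos] at hω
  simpa [mul_comm] using hω

end ACSS
end
end

section
/- For any n ≥ 1, any μ, μ' ∈ ℝⁿ, and any symmetric positive definite Σ ∈ ℝ^{n×n}, the total variation distance between the multivariate normal distributions N(μ,Σ) and N(μ',Σ) satisfies d_TV(N(μ,Σ), N(μ',Σ)) ≤ (1/2)·‖Σ^{-1/2}(μ − μ')‖. -/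
open MeasureTheory Matrix
open scoped ENNReal

noncomputable section

namespace ACSS

/-- Total variation distance between two measures. -/
def dTV {β : Type*} [MeasurableSpace β] (μ ν : Measure β) : ℝ :=
  ⨆ s : {s : Set β // MeasurableSet s}, |(μ s).toReal - (ν s).toReal|

/-- The multivariate normal distribution `N(m, S)` on `ℝⁿ` (for positive definite `S`),
defined through its Lebesgue density. -/
def mvNormal {n : ℕ} (m : Fin n → ℝ) (S : Matrix (Fin n) (Fin n) ℝ) : Measure (Fin n → ℝ) :=
  volume.withDensity fun x =>
    ENNReal.ofReal (Real.exp (-((x - m) ⬝ᵥ S⁻¹.mulVec (x - m)) / 2) /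
      Real.sqrt ((2 * Real.pi) ^ n * S.det))

lemma exists_factor {n : ℕ} {T : Matrix (Fin n) (Fin n) ℝ} (hT : T.PosDef) :
    ∃ A : Matrix (Fin n) (Fin n) ℝ, T = Aᵀ * A := by
  open scoped MatrixOrder Matrix.Norms.L2Operator in
  obtain ⟨A, hA⟩ := CStarAlgebra.nonneg_iff_eq_star_mul_self.mp hT.posSemidef.nonneg
  refine ⟨A, ?_⟩
  rw [hA, star_eq_conjTranspose, conjTranspose_eq_transpose_of_trivial]

lemma integral_std (n : ℕ) :
    ∫ y : Fin n → ℝ, Real.exp (-(y ⬝ᵥ y) / 2) = Real.sqrt ((2 * Real.pi) ^ n) := by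
  have h1 : ∀ y : Fin n → ℝ, Real.exp (-(y ⬝ᵥ y) / 2) =
      ∏ i, Real.exp (-(1/2) * (y i) ^ 2) := by
    intro y
    rw [← Real.exp_sum, ← Finset.mul_sum]
    congr 1
    simp only [dotProduct, ← sq]
    ring
  simp_rw [h1]
  rw [integral_fintype_prod_volume_eq_pow (fun t : ℝ => Real.exp (-(1/2) * t ^ 2)),
    integral_gaussian, Fintype.card_fin]
  have : Real.pi / (1/2) = 2 * Real.pi := by ring
  rw [this, Real.sqrt_eq_rpow, Real.sqrt_eq_rpow, ← Real.rpow_natCast, ← Real.rpow_natCast,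
    ← Real.rpow_mul (by positivity), ← Real.rpow_mul (by positivity),
    mul_comm (n : ℝ)]

lemma integral_gauss {n : ℕ} {S : Matrix (Fin n) (Fin n) ℝ} (hS : S.PosDef) :
    ∫ x : Fin n → ℝ, Real.exp (-(x ⬝ᵥ S⁻¹.mulVec x) / 2) /
      Real.sqrt ((2 * Real.pi) ^ n * S.det) = 1 := by
  obtain ⟨A, hA⟩ := exists_factor hS.inv
  have hd := hS.det_pos
  have hdet : S.det⁻¹ = A.det ^ 2 := by
    have := congrArg Matrix.det hA
    rw [det_mul, det_transpose, det_nonsing_inv, Ring.inverse_eq_inv'] at this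
    rw [this, sq]
  have hA0 : A.det ≠ 0 := by
    intro h
    rw [h] at hdet
    simp at hdet
    exact hd.ne' hdet
  have h1 : ∀ x : Fin n → ℝ, x ⬝ᵥ S⁻¹.mulVec x = (toLin' A x) ⬝ᵥ (toLin' A x) := by
    intro x
    rw [hA, ← mulVec_mulVec, dotProduct_mulVec, vecMul_transpose, toLin'_apply]
  rw [integral_div]
  simp_rw [h1]
  have h2 : ∫ x : Fin n → ℝ, Real.exp (-((toLin' A x) ⬝ᵥ (toLin' A x)) / 2) =
      ∫ y, Real.exp (-(y ⬝ᵥ y) / 2) ∂(Measure.map (toLin' A) volume) := by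
    rw [integral_map]
    · exact (LinearMap.continuous_of_finiteDimensional _).measurable.aemeasurable
    · apply Continuous.aestronglyMeasurable
      simp only [dotProduct]
      fun_prop
  rw [h2, Real.map_matrix_volume_pi_eq_smul_volume_pi hA0, integral_smul_measure, integral_std,
    ENNReal.toReal_ofReal (abs_nonneg _), Real.sqrt_mul (by positivity)]
  have h3 : |(A.det)⁻¹| = Real.sqrt S.det := by
    rw [← Real.sqrt_sq_eq_abs, inv_pow, ← hdet, inv_inv]
  rw [h3, smul_eq_mul, mul_comm]
  apply div_self
  positivity

lemma exp_ineq (l : ℝ) : (Real.exp l - 1) ^ 2 ≤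
    (Real.exp l - 1) * l * ((Real.exp l + 1) / 2) := by
  have hm : Monotone (fun l : ℝ => l * (Real.exp l + 1) - 2 * (Real.exp l - 1)) := by
    have hd : ∀ x : ℝ, HasDerivAt (fun l : ℝ => l * (Real.exp l + 1) - 2 * (Real.exp l - 1))
        (1 * (Real.exp x + 1) + x * Real.exp x - 2 * Real.exp x) x := fun x =>
      ((hasDerivAt_id x).mul ((Real.hasDerivAt_exp x).add_const 1)).sub
        (((Real.hasDerivAt_exp x).sub_const 1).const_mul 2)
    apply monotone_of_deriv_nonneg
    · exact fun x => (hd x).differentiableAt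
    · intro x
      rw [(hd x).deriv]
      have h1 := Real.add_one_le_exp (-x)
      have h2 : Real.exp (-x) * Real.exp x = 1 := by rw [← Real.exp_add]; simp
      nlinarith [Real.exp_pos x]
  rcases le_total 0 l with h | h
  · have h1 := hm h
    have h2 := Real.one_le_exp h
    simp at h1
    nlinarith
  · have h1 := hm h
    have h2 := Real.exp_le_one_iff.mpr h
    simp at h1
    nlinarith

lemma abs_ineq {p q l a : ℝ} (hq : 0 < q) (hp : p = q * Real.exp l) (ha : 0 < a) :
    |p - q| ≤ 1 / 2 * (a * ((p - q) * l) + (p + q) / (2 * a)) := by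
  have h := exp_ineq l
  have h1 : (p - q) ^ 2 ≤ (a * ((p - q) * l)) * ((p + q) / (2 * a)) := by
    have : (a * ((p - q) * l)) * ((p + q) / (2 * a)) =
        q ^ 2 * ((Real.exp l - 1) * l * ((Real.exp l + 1) / 2)) := by
      rw [hp]; field_simp
    rw [this, hp]
    nlinarith [sq_nonneg q]
  have hpp : 0 < p := by rw [hp]; positivity
  have hv : 0 < (p + q) / (2 * a) := by positivity
  have hu : 0 ≤ a * ((p - q) * l) := by
    by_contra hc
    push Not at hc
    nlinarith [sq_nonneg (p - q)]
  apply abs_le_of_sq_le_sq _ (by positivity)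
  nlinarith [sq_nonneg (a * ((p - q) * l) - (p + q) / (2 * a))]

lemma half_l1 {α : Type*} [MeasurableSpace α] {ν : Measure α} {f : α → ℝ}
    (hf : Integrable f ν) (h0 : ∫ x, f x ∂ν = 0) {s : Set α} (hs : MeasurableSet s) :
    |∫ x in s, f x ∂ν| ≤ 1 / 2 * ∫ x, |f x| ∂ν := by
  have h1 := integral_add_compl hs hf
  have h2 := integral_add_compl hs hf.abs
  have h3 : |∫ x in s, f x ∂ν| ≤ ∫ x in s, |f x| ∂ν := abs_integral_le_integral_abs
  have h4 : |∫ x in sᶜ, f x ∂ν| ≤ ∫ x in sᶜ, |f x| ∂ν := abs_integral_le_integral_abs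
  have h5 : ∫ x in sᶜ, f x ∂ν = - ∫ x in s, f x ∂ν := by linarith
  rw [h5, abs_neg] at h4
  linarith

/-- Centred density. -/
def dens {n : ℕ} (S : Matrix (Fin n) (Fin n) ℝ) (x : Fin n → ℝ) : ℝ :=
  Real.exp (-(x ⬝ᵥ S⁻¹.mulVec x) / 2) / Real.sqrt ((2 * Real.pi) ^ n * S.det)

lemma quad_add {n : ℕ} {S : Matrix (Fin n) (Fin n) ℝ} (hS : S.PosDef) (x d : Fin n → ℝ) :
    (x + d) ⬝ᵥ S⁻¹.mulVec (x + d) =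
      x ⬝ᵥ S⁻¹.mulVec x + 2 * (x ⬝ᵥ S⁻¹.mulVec d) + d ⬝ᵥ S⁻¹.mulVec d := by
  have hs : d ⬝ᵥ S⁻¹.mulVec x = x ⬝ᵥ S⁻¹.mulVec d := by
    have hT : (S⁻¹)ᵀ = S⁻¹ := by
      have := hS.inv.isHermitian.eq
      rwa [conjTranspose_eq_transpose_of_trivial] at this
    rw [dotProduct_mulVec, ← mulVec_transpose, hT, dotProduct_comm]
  rw [mulVec_add, dotProduct_add, add_dotProduct, add_dotProduct, hs]
  ring

lemma dens_add {n : ℕ} {S : Matrix (Fin n) (Fin n) ℝ} (hS : S.PosDef) (x d : Fin n → ℝ) :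
    dens S (x + d) = dens S x *
      Real.exp (-(x ⬝ᵥ S⁻¹.mulVec d) - (d ⬝ᵥ S⁻¹.mulVec d) / 2) := by
  unfold dens
  rw [quad_add hS, div_mul_eq_mul_div, ← Real.exp_add]
  congr 2
  ring

lemma dens_pos {n : ℕ} {S : Matrix (Fin n) (Fin n) ℝ} (hS : S.PosDef) (x : Fin n → ℝ) :
    0 < dens S x := by
  have := hS.det_pos
  unfold dens
  positivity

lemma dens_neg {n : ℕ} (S : Matrix (Fin n) (Fin n) ℝ) (x : Fin n → ℝ) :
    dens S (-x) = dens S x := by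
  unfold dens
  rw [mulVec_neg, neg_dotProduct_neg]

lemma continuous_dens {n : ℕ} (S : Matrix (Fin n) (Fin n) ℝ) : Continuous (dens S) := by
  unfold dens
  simp only [dotProduct, mulVec]
  fun_prop

lemma integral_dens {n : ℕ} {S : Matrix (Fin n) (Fin n) ℝ} (hS : S.PosDef) :
    ∫ x, dens S x = 1 := integral_gauss hS

lemma integrable_dens {n : ℕ} {S : Matrix (Fin n) (Fin n) ℝ} (hS : S.PosDef) :
    Integrable (dens S) := by
  apply Integrable.of_integral_ne_zero
  rw [integral_dens hS]
  exact one_ne_zero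

lemma integrable_lin {n : ℕ} {S : Matrix (Fin n) (Fin n) ℝ} (hS : S.PosDef) (d : Fin n → ℝ) :
    Integrable (fun x => dens S x * (x ⬝ᵥ S⁻¹.mulVec d)) := by
  have h1 : ∀ e : Fin n → ℝ, Integrable (fun x => dens S (x + e)) := fun e =>
    (integrable_dens hS).comp_add_right e
  refine Integrable.mono' (((h1 d).add (h1 (-d))).const_mul
    (Real.exp ((d ⬝ᵥ S⁻¹.mulVec d) / 2))) ?_ (Filter.Eventually.of_forall fun x => ?_)
  · apply Continuous.aestronglyMeasurable
    have := continuous_dens S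
    simp only [dotProduct]
    fun_prop
  · have hp := dens_pos hS x
    simp only [Pi.add_apply]
    rw [dens_add hS, dens_add hS, Real.norm_eq_abs, abs_mul, abs_of_pos hp, mulVec_neg,
      neg_dotProduct_neg, dotProduct_neg]
    generalize x ⬝ᵥ S⁻¹.mulVec d = t
    generalize d ⬝ᵥ S⁻¹.mulVec d = Q
    rw [← mul_add, mul_left_comm, mul_add (Real.exp _), ← Real.exp_add, ← Real.exp_add]
    apply mul_le_mul_of_nonneg_left _ hp.le
    have e1 : Q / 2 + (-t - Q / 2) = -t := by ring
    have e2 : Q / 2 + (- -t - Q / 2) = t := by ring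
    rw [e1, e2, abs_le]
    have := Real.add_one_le_exp t
    have := Real.add_one_le_exp (-t)
    have := Real.exp_pos t
    have := Real.exp_pos (-t)
    constructor <;> linarith

lemma integral_lin {n : ℕ} (S : Matrix (Fin n) (Fin n) ℝ) (d : Fin n → ℝ) :
    ∫ x, dens S x * (x ⬝ᵥ S⁻¹.mulVec d) = 0 := by
  have h := integral_neg_eq_self (fun x => dens S x * (x ⬝ᵥ S⁻¹.mulVec d)) volume
  simp only [dens_neg, neg_dotProduct, mul_neg, integral_neg] at h
  linarith

lemma mvNormal_apply {n : ℕ} {S : Matrix (Fin n) (Fin n) ℝ} (hS : S.PosDef) (m : Fin n → ℝ)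
    {s : Set (Fin n → ℝ)} (hs : MeasurableSet s) :
    (mvNormal m S s).toReal = ∫ x in s, dens S (x - m) := by
  rw [mvNormal, withDensity_apply _ hs, integral_eq_lintegral_of_nonneg_ae]
  · rfl
  · exact Filter.Eventually.of_forall fun x => (dens_pos hS _).le
  · exact ((continuous_dens S).comp (by fun_prop)).aestronglyMeasurable

/-- Symmetrised KL divergence, up to an affine shift. -/
lemma integral_affine {n : ℕ} {S : Matrix (Fin n) (Fin n) ℝ} (hS : S.PosDef)
    (m d : Fin n → ℝ) (c : ℝ) :
    Integrable (fun x => dens S (x - m) * ((x - m) ⬝ᵥ S⁻¹.mulVec d + c)) ∧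
    ∫ x, dens S (x - m) * ((x - m) ⬝ᵥ S⁻¹.mulVec d + c) = c := by
  have h1 : Integrable (fun x => dens S x * (x ⬝ᵥ S⁻¹.mulVec d + c)) := by
    simp only [mul_add]
    exact (integrable_lin hS d).add ((integrable_dens hS).mul_const c)
  refine ⟨h1.comp_sub_right m, ?_⟩
  rw [integral_sub_right_eq_self (fun x => dens S x * (x ⬝ᵥ S⁻¹.mulVec d + c)) m]
  simp only [mul_add]
  rw [integral_add (integrable_lin hS d) ((integrable_dens hS).mul_const c), integral_lin,
    integral_mul_const, integral_dens hS]
  ring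

/-- **TV distance between Gaussians with common covariance**:
`d_TV(N(μ,Σ), N(μ',Σ)) ≤ (1/2)‖Σ^{-1/2}(μ − μ')‖ = (1/2)√((μ−μ')ᵀΣ⁻¹(μ−μ'))`. -/
theorem dTV_mvNormal_le
    {n : ℕ} (hn : 1 ≤ n) (μ μ' : Fin n → ℝ) (S : Matrix (Fin n) (Fin n) ℝ)
    (hS : S.PosDef) :
    dTV (mvNormal μ S) (mvNormal μ' S) ≤
      1 / 2 * Real.sqrt ((μ - μ') ⬝ᵥ S⁻¹.mulVec (μ - μ')) := by
  have hp : Integrable (fun x => dens S (x - μ)) := (integrable_dens hS).comp_sub_right μ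
  have hq : Integrable (fun x => dens S (x - μ')) := (integrable_dens hS).comp_sub_right μ'
  have ip : ∫ x, dens S (x - μ) = 1 := by
    rw [integral_sub_right_eq_self (dens S) μ, integral_dens hS]
  have iq : ∫ x, dens S (x - μ') = 1 := by
    rw [integral_sub_right_eq_self (dens S) μ', integral_dens hS]
  have : Nonempty {s : Set (Fin n → ℝ) // MeasurableSet s} := ⟨⟨∅, MeasurableSet.empty⟩⟩
  apply ciSup_le
  rintro ⟨s, hs⟩
  by_cases hd : μ = μ'
  · subst hd
    simp
  simp only
  rw [mvNormal_apply hS _ hs, mvNormal_apply hS _ hs,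
    ← integral_sub hp.integrableOn hq.integrableOn]
  refine (half_l1 (hp.sub hq) (by
    simp only [Pi.sub_apply]; rw [integral_sub hp hq, ip, iq, sub_self]) hs).trans ?_
  apply mul_le_mul_of_nonneg_left _ (by norm_num)
  set Q := (μ - μ') ⬝ᵥ S⁻¹.mulVec (μ - μ') with hQ
  have hQpos : 0 < Q := by
    have := hS.inv.dotProduct_mulVec_pos (sub_ne_zero.mpr hd)
    rwa [star_trivial] at this
  set r := Real.sqrt Q with hr
  have hrpos : 0 < r := Real.sqrt_pos.mpr hQpos
  have hrr : r * r = Q := Real.mul_self_sqrt hQpos.le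
  obtain ⟨A1, A2⟩ := integral_affine hS μ (μ - μ') (Q / 2)
  obtain ⟨B1, B2⟩ := integral_affine hS μ' (μ - μ') (-(Q / 2))
  have key : ∀ x, |dens S (x - μ) - dens S (x - μ')| ≤
      1 / 2 * (r⁻¹ * (dens S (x - μ) * ((x - μ) ⬝ᵥ S⁻¹.mulVec (μ - μ') + Q / 2)
        - dens S (x - μ') * ((x - μ') ⬝ᵥ S⁻¹.mulVec (μ - μ') + -(Q / 2)))
        + (dens S (x - μ) + dens S (x - μ')) / (2 * r⁻¹)) := by
    intro x
    have e : x - μ' = (x - μ) + (μ - μ') := by abel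
    have hl : (x - μ') ⬝ᵥ S⁻¹.mulVec (μ - μ') + -(Q / 2) =
        (x - μ) ⬝ᵥ S⁻¹.mulVec (μ - μ') + Q / 2 := by
      rw [e, add_dotProduct, ← hQ]; ring
    rw [hl, ← sub_mul]
    apply abs_ineq (dens_pos hS _) _ (inv_pos.mpr hrpos)
    rw [e, dens_add hS, ← hQ, mul_assoc, ← Real.exp_add]
    ring_nf
    simp
  have I1 := (A1.sub B1).const_mul r⁻¹
  have I2 := (hp.add hq).div_const (2 * r⁻¹)
  simp only [Pi.add_apply, Pi.sub_apply] at I1 I2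
  refine (integral_mono (hp.sub hq).abs ((I1.add I2).const_mul (1 / 2)) key).trans (le_of_eq ?_)
  simp only [Pi.add_apply, Pi.sub_apply]
  rw [integral_const_mul, integral_add I1 I2]
  rw [integral_const_mul, integral_sub A1 B1, A2, B2, integral_div, integral_add hp hq, ip, iq]
  field_simp
  nlinarith

end ACSS
end
end

section
/- Let n, d ≥ 1, Z ∈ ℝ^{n×d}, ν, σ > 0, and θ0, θ̂ ∈ ℝ^d. Let Σ = ν²·(I_n + (d/(σ²ν²))ZZᵀ)^{-1}, and let m_0, m_1 ∈ ℝⁿ satisfy m_0 − m_1 = (I_n + (d/(σ²ν²))ZZᵀ)^{-1}Z(θ0 − θ̂). Then d_TV(N(m_0,Σ), N(m_1,Σ)) ≤ (σ/(2√d))·‖θ̂ − θ0‖. (Key step of the proof of Theorem 3: the total variation distance between the true and plug-in conditional distributions in the Gaussian linear model is at most (σ/(2√d))·‖θ̂ − θ0‖.) -/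
open MeasureTheory Matrix
open scoped ENNReal

noncomputable section

namespace ACSS

theorem tv_aux {α : Type*} [MeasurableSpace α] {μ : Measure α} {p q r : α → ℝ} {ρ ε : ℝ}
    (hp : Integrable p μ) (hq : Integrable q μ) (hr : Integrable r μ)
    (hp0 : ∀ x, 0 ≤ p x) (hq0 : ∀ x, 0 ≤ q x) (hr0 : ∀ x, 0 ≤ r x)
    (hpq : ∀ x, r x ^ 2 = p x * q x)
    (hp1 : ∫ x, p x ∂μ = 1) (hq1 : ∫ x, q x ∂μ = 1) (hrρ : ∫ x, r x ∂μ = ρ)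
    (hρ1 : ρ ≤ 1) (hρ : 1 - ρ ≤ ε ^ 2 / 8) (hε : 0 < ε) {s : Set α} (hs : MeasurableSet s) :
    |(∫ x in s, p x ∂μ) - ∫ x in s, q x ∂μ| ≤ ε / 2 := by
  have hd : Integrable (fun x => p x - q x) μ := hp.sub hq
  have e1 : (∫ x in s, p x ∂μ) - ∫ x in s, q x ∂μ = ∫ x in s, (p x - q x) ∂μ :=
    (integral_sub hp.integrableOn hq.integrableOn).symm
  have e2 := integral_add_compl hs hd
  have e3 := integral_add_compl hs hd.norm
  have e4 : ∫ x, (p x - q x) ∂μ = 0 := by rw [integral_sub hp hq]; linarith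
  have b1 := norm_integral_le_integral_norm (μ := μ.restrict s) (fun x => p x - q x)
  have b2 := norm_integral_le_integral_norm (μ := μ.restrict sᶜ) (fun x => p x - q x)
  have pt : ∀ x, ‖p x - q x‖ ≤ (2 / ε) * (p x + q x - 2 * r x) + (ε / 8) * (p x + q x + 2 * r x) := by
    intro x
    have hA : 0 ≤ p x + q x - 2 * r x := by
      nlinarith [sq_nonneg (p x - q x), hp0 x, hq0 x, hr0 x, hpq x,
        abs_le_of_sq_le_sq' (a := 2 * r x) (b := p x + q x) (by nlinarith [sq_nonneg (p x - q x), hpq x]) (by linarith [hp0 x, hq0 x])]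
    have hB : 0 ≤ p x + q x + 2 * r x := by linarith [hp0 x, hq0 x, hr0 x]
    have hAB : (p x - q x) ^ 2 = (p x + q x - 2 * r x) * (p x + q x + 2 * r x) := by
      nlinarith [hpq x]
    rw [Real.norm_eq_abs]
    apply abs_le_of_sq_le_sq _ (by positivity)
    rw [hAB]
    have : 2 / ε * (ε / 8) = 1 / 4 := by field_simp; norm_num
    nlinarith [sq_nonneg ((2 / ε) * (p x + q x - 2 * r x) - (ε / 8) * (p x + q x + 2 * r x))]
  have i1 : Integrable (fun x => p x + q x - 2 * r x) μ := (hp.add hq).sub (hr.const_mul 2)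
  have i2 : Integrable (fun x => p x + q x + 2 * r x) μ := (hp.add hq).add (hr.const_mul 2)
  have v1 : ∫ x, (p x + q x - 2 * r x) ∂μ = 2 - 2 * ρ := by
    rw [integral_sub (f := fun x => p x + q x) (hp.add hq) (hr.const_mul 2), integral_add hp hq, integral_const_mul]; linarith
  have v2 : ∫ x, (p x + q x + 2 * r x) ∂μ = 2 + 2 * ρ := by
    rw [integral_add (f := fun x => p x + q x) (hp.add hq) (hr.const_mul 2), integral_add hp hq, integral_const_mul]; linarith
  have big := integral_mono hd.norm ((i1.const_mul (2 / ε)).add (i2.const_mul (ε / 8))) pt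
  simp only [Pi.add_apply] at big
  rw [integral_add (i1.const_mul _) (i2.const_mul _), integral_const_mul, integral_const_mul, v1, v2] at big
  have w1 : 2 / ε * (2 - 2 * ρ) ≤ ε / 2 := by
    rw [div_mul_eq_mul_div, div_le_iff₀ hε]; nlinarith
  have w2 : ε / 8 * (2 + 2 * ρ) ≤ ε / 2 := by nlinarith
  rw [e1]
  have : ∫ x in sᶜ, (p x - q x) ∂μ = - ∫ x in s, (p x - q x) ∂μ := by linarith
  rw [this, norm_neg] at b2
  rw [Real.norm_eq_abs] at b1 b2
  linarith

theorem lin_aux {n d : ℕ} (Z : Matrix (Fin n) (Fin d) ℝ) (c : ℝ) (hc : 0 < c) (u : Fin n → ℝ)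
    (w : Fin d → ℝ) (h : (1 + c • (Z * Zᵀ)) *ᵥ u = Z *ᵥ w) :
    c * (u ⬝ᵥ ((1 + c • (Z * Zᵀ)) *ᵥ u)) ≤ w ⬝ᵥ w := by
  have h1 : u ⬝ᵥ ((1 + c • (Z * Zᵀ)) *ᵥ u) = u ⬝ᵥ u + c * ((Zᵀ *ᵥ u) ⬝ᵥ (Zᵀ *ᵥ u)) := by
    rw [add_mulVec, one_mulVec, dotProduct_add, smul_mulVec, dotProduct_smul, ← mulVec_mulVec,
      dotProduct_mulVec u Z, ← mulVec_transpose, smul_eq_mul]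
  have h2 : u ⬝ᵥ ((1 + c • (Z * Zᵀ)) *ᵥ u) = (Zᵀ *ᵥ u) ⬝ᵥ w := by
    rw [h, dotProduct_mulVec u Z, ← mulVec_transpose]
  set y := Zᵀ *ᵥ u
  have h3 : 0 ≤ (w - c • y) ⬝ᵥ (w - c • y) := Finset.sum_nonneg fun i _ => mul_self_nonneg _
  have h4 : 0 ≤ u ⬝ᵥ u := Finset.sum_nonneg fun i _ => mul_self_nonneg _
  simp only [sub_dotProduct, dotProduct_sub, smul_dotProduct, dotProduct_smul, smul_eq_mul,
    dotProduct_comm w y] at h3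
  rw [h2] at h1 ⊢
  nlinarith

theorem gauss_B {n : ℕ} (B : Matrix (Fin n) (Fin n) ℝ) (hB : B.det ≠ 0) :
    Integrable (fun x : Fin n → ℝ => Real.exp (-((B *ᵥ x) ⬝ᵥ (B *ᵥ x)) / 2)) ∧
    ∫ x : Fin n → ℝ, Real.exp (-((B *ᵥ x) ⬝ᵥ (B *ᵥ x)) / 2) =
      |B.det|⁻¹ * Real.sqrt (2 * Real.pi) ^ n := by
  set g : (Fin n → ℝ) → ℝ := fun x => Real.exp (-(x ⬝ᵥ x) / 2) with hg
  have hg' : g = fun x => ∏ i, Real.exp (-(1/2) * (x i) ^ 2) := by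
    funext x
    rw [← Real.exp_sum]
    show Real.exp _ = Real.exp _
    congr 1
    simp only [dotProduct, ← Finset.mul_sum, pow_two]
    ring
  have gi : Integrable g := by
    rw [hg']
    exact Integrable.fintype_prod (f := fun _ t => Real.exp (-(1/2) * t ^ 2)) (μ := fun _ => volume)
      fun i => integrable_exp_neg_mul_sq (by norm_num)
  have gv : ∫ x, g x = Real.sqrt (2 * Real.pi) ^ n := by
    rw [hg', integral_fintype_prod_volume_eq_pow (fun t : ℝ => Real.exp (-(1/2) * t ^ 2)),
      integral_gaussian, Fintype.card_fin]
    congr 2; ring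
  have hm := Real.map_matrix_volume_pi_eq_smul_volume_pi hB
  have hc : Continuous (toLin' B) := LinearMap.continuous_of_finiteDimensional _
  have hmeas : AEMeasurable (toLin' B) (volume : Measure (Fin n → ℝ)) := hc.aemeasurable
  have gs : AEStronglyMeasurable g (Measure.map (toLin' B) volume) := by
    have : Continuous g := by rw [hg']; fun_prop
    exact this.aestronglyMeasurable
  have key : (fun x : Fin n → ℝ => Real.exp (-((B *ᵥ x) ⬝ᵥ (B *ᵥ x)) / 2)) = g ∘ (toLin' B) := by
    funext x; simp [hg]
  constructor
  · rw [key, ← integrable_map_measure gs hmeas, hm]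
    exact gi.smul_measure ENNReal.ofReal_ne_top
  · have := integral_map hmeas gs
    rw [hm, integral_smul_measure, gv, ENNReal.toReal_ofReal (abs_nonneg _), abs_inv, smul_eq_mul] at this
    rw [this, key]; rfl

theorem gauss_S {n : ℕ} (S : Matrix (Fin n) (Fin n) ℝ) (hS : S.PosDef) :
    Integrable (fun x : Fin n → ℝ => Real.exp (-(x ⬝ᵥ S⁻¹.mulVec x) / 2) /
      Real.sqrt ((2 * Real.pi) ^ n * S.det)) ∧
    ∫ x : Fin n → ℝ, Real.exp (-(x ⬝ᵥ S⁻¹.mulVec x) / 2) /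
      Real.sqrt ((2 * Real.pi) ^ n * S.det) = 1 := by
  obtain ⟨B, hB⟩ : ∃ B : Matrix (Fin n) (Fin n) ℝ, S⁻¹ = Bᵀ * B := by
    open scoped MatrixOrder Matrix.Norms.L2Operator in
    obtain ⟨B, hB⟩ := CStarAlgebra.nonneg_iff_eq_star_mul_self.mp hS.inv.posSemidef.nonneg
    exact ⟨B, by simpa [Matrix.star_eq_conjTranspose] using hB⟩
  have hdet : S⁻¹.det = B.det ^ 2 := by rw [hB, det_mul, det_transpose, sq]
  have hSd := hS.det_pos
  have hBd : B.det ≠ 0 := by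
    intro h
    have := hS.inv.det_pos
    rw [hdet, h] at this
    simp at this
  have hSdet : S.det = (B.det ^ 2)⁻¹ := by
    rw [← hdet, det_nonsing_inv, Ring.inverse_eq_inv', inv_inv]
  have hq : ∀ x : Fin n → ℝ, x ⬝ᵥ S⁻¹.mulVec x = (B *ᵥ x) ⬝ᵥ (B *ᵥ x) := by
    intro x
    rw [hB, ← mulVec_mulVec, dotProduct_mulVec x Bᵀ, vecMul_transpose]
  have hK : Real.sqrt ((2 * Real.pi) ^ n * S.det) = |B.det|⁻¹ * Real.sqrt (2 * Real.pi) ^ n := by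
    rw [hSdet, Real.sqrt_mul (by positivity), Real.sqrt_inv, Real.sqrt_sq_eq_abs, mul_comm]
    congr 1
    rw [Real.sqrt_eq_iff_mul_self_eq (by positivity) (by positivity), ← mul_pow,
      Real.mul_self_sqrt (by positivity)]
  obtain ⟨h1, h2⟩ := gauss_B B hBd
  simp only [hq, hK]
  refine ⟨h1.div_const _, ?_⟩
  rw [integral_div, h2]
  exact div_self (by positivity)

theorem dTV_mvNormal_le_s14 {n : ℕ} (S : Matrix (Fin n) (Fin n) ℝ) (hS : S.PosDef) (m0 m1 : Fin n → ℝ)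
    (ε : ℝ) (hε : 0 < ε) (h : (m0 - m1) ⬝ᵥ S⁻¹ *ᵥ (m0 - m1) ≤ ε ^ 2) :
    dTV (mvNormal m0 S) (mvNormal m1 S) ≤ ε / 2 := by
  obtain ⟨gi, gv⟩ := gauss_S S hS
  set K := Real.sqrt ((2 * Real.pi) ^ n * S.det) with hK
  set g : (Fin n → ℝ) → ℝ := fun x => Real.exp (-(x ⬝ᵥ S⁻¹.mulVec x) / 2) / K with hg
  have g0 : ∀ x, 0 ≤ g x := fun x => by positivity
  have hi : ∀ m, Integrable (fun x => g (x - m)) := fun m => gi.comp_sub_right m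
  have hv : ∀ m, ∫ x, g (x - m) = 1 := fun m => by rw [integral_sub_right_eq_self]; exact gv
  have hmeas : ∀ m (s : Set (Fin n → ℝ)), MeasurableSet s →
      (mvNormal m S s).toReal = ∫ x in s, g (x - m) := by
    intro m s hs
    rw [mvNormal, withDensity_apply _ hs]
    have := ofReal_integral_eq_lintegral_ofReal (hi m).integrableOn
      (ae_of_all (volume.restrict s) fun x => g0 (x - m))
    rw [← hK, ← this, ENNReal.toReal_ofReal (integral_nonneg fun x => g0 _)]
  set δ := (m0 - m1) ⬝ᵥ S⁻¹ *ᵥ (m0 - m1) with hδ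
  have hδ0 : 0 ≤ δ := hS.inv.posSemidef.dotProduct_mulVec_nonneg (m0 - m1)
  have hsymm : ∀ x y : Fin n → ℝ, x ⬝ᵥ S⁻¹ *ᵥ y = y ⬝ᵥ S⁻¹ *ᵥ x := by
    intro x y
    have ht : S⁻¹ᵀ = S⁻¹ := by simpa [IsHermitian] using hS.inv.isHermitian
    rw [dotProduct_mulVec, ← mulVec_transpose, ht, dotProduct_comm]
  haveI : Nonempty {s : Set (Fin n → ℝ) // MeasurableSet s} := ⟨⟨∅, MeasurableSet.empty⟩⟩
  refine ciSup_le fun ⟨s, hs⟩ => ?_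
  simp only [hmeas _ s hs]
  set m := (1 / 2 : ℝ) • (m0 + m1) with hm
  refine tv_aux (r := fun x => Real.exp (-δ / 8) * g (x - m)) (ρ := Real.exp (-δ / 8)) (hi m0) (hi m1)
    ((hi m).const_mul _)
    (fun _ => g0 _) (fun _ => g0 _) (fun x => mul_nonneg (Real.exp_pos _).le (g0 _)) ?_
    (hv m0) (hv m1) ?_ ?_ ?_ hε hs
  · intro x
    simp only [hg]
    have e : ∀ a b c : ℝ, Real.exp a * (Real.exp b / c) = Real.exp (a + b) / c := by
      intro a b c; rw [Real.exp_add]; ring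
    rw [e, div_pow, div_mul_div_comm, ← Real.exp_add, sq K, ← Real.exp_nat_mul]
    congr 2
    have hx0 : x - m0 = (x - m) - (1 / 2 : ℝ) • (m0 - m1) := by rw [hm]; module
    have hx1 : x - m1 = (x - m) + (1 / 2 : ℝ) • (m0 - m1) := by rw [hm]; module
    rw [hx0, hx1, hδ]
    generalize x - m = y
    generalize m0 - m1 = u
    simp only [mulVec_sub, mulVec_add, mulVec_smul, sub_dotProduct, dotProduct_sub, add_dotProduct,
      dotProduct_add, smul_dotProduct, dotProduct_smul, smul_eq_mul, hsymm u y]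
    push_cast
    ring
  · rw [integral_const_mul, hv, mul_one]
  · rw [Real.exp_le_one_iff]; linarith
  · linarith [Real.add_one_le_exp (-δ / 8)]

/-- **Key step of the proof of Theorem 3**: for `Σ = ν²(I_n + (d/(σ²ν²))ZZᵀ)⁻¹` and means
with `m₀ − m₁ = (I_n + (d/(σ²ν²))ZZᵀ)⁻¹ Z(θ₀ − θ̂)`, the total variation distance between
`N(m₀,Σ)` and `N(m₁,Σ)` is at most `(σ/(2√d))‖θ̂ − θ₀‖`. -/
theorem dTV_plugin_gaussian_le
    {n d : ℕ} (hn : 1 ≤ n) (hd : 1 ≤ d) (Z : Matrix (Fin n) (Fin d) ℝ)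
    (ν σ : ℝ) (hν : 0 < ν) (hσ : 0 < σ)
    (θ0 θh : Fin d → ℝ) (m0 m1 : Fin n → ℝ)
    (hm : m0 - m1 =
      ((1 : Matrix (Fin n) (Fin n) ℝ) +
        ((d : ℝ) / (σ ^ 2 * ν ^ 2)) • (Z * Zᵀ))⁻¹.mulVec (Z.mulVec (θ0 - θh))) :
    dTV
        (mvNormal m0 (ν ^ 2 • ((1 : Matrix (Fin n) (Fin n) ℝ) +
          ((d : ℝ) / (σ ^ 2 * ν ^ 2)) • (Z * Zᵀ))⁻¹))
        (mvNormal m1 (ν ^ 2 • ((1 : Matrix (Fin n) (Fin n) ℝ) +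
          ((d : ℝ) / (σ ^ 2 * ν ^ 2)) • (Z * Zᵀ))⁻¹)) ≤
      σ / (2 * Real.sqrt d) * Real.sqrt (∑ i, (θh i - θ0 i) ^ 2) := by
  set c : ℝ := (d : ℝ) / (σ ^ 2 * ν ^ 2) with hc
  have hd0 : (0 : ℝ) < d := by exact_mod_cast hd
  have hc0 : 0 < c := by positivity
  set A := (1 : Matrix (Fin n) (Fin n) ℝ) + c • (Z * Zᵀ) with hA
  have hAp : A.PosDef := by
    refine PosDef.one.add_posSemidef (PosSemidef.smul ?_ hc0.le)
    simpa using posSemidef_self_mul_conjTranspose Z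
  have hAd : IsUnit A.det := hAp.det_pos.ne'.isUnit
  have hSp : (ν ^ 2 • A⁻¹).PosDef := hAp.inv.smul (by positivity)
  have hSi : (ν ^ 2 • A⁻¹)⁻¹ = (ν ^ 2)⁻¹ • A := by
    apply inv_eq_left_inv
    rw [smul_mul_smul_comm, mul_nonsing_inv _ hAd, inv_mul_cancel₀ (by positivity), one_smul]
  have hAu : A *ᵥ (m0 - m1) = Z *ᵥ (θ0 - θh) := by
    rw [hm, mulVec_mulVec, mul_nonsing_inv _ hAd, one_mulVec]
  have hl := lin_aux Z c hc0 (m0 - m1) (θ0 - θh) hAu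
  rw [← hA] at hl
  have hw : (θ0 - θh) ⬝ᵥ (θ0 - θh) = ∑ i, (θh i - θ0 i) ^ 2 := by
    simp only [dotProduct, Pi.sub_apply]
    exact Finset.sum_congr rfl fun i _ => by ring
  rw [hw] at hl
  set W := ∑ i, (θh i - θ0 i) ^ 2 with hW
  have hW0 : 0 ≤ W := Finset.sum_nonneg fun i _ => sq_nonneg _
  set R := σ / Real.sqrt d * Real.sqrt W with hR
  have hR0 : 0 ≤ R := by positivity
  have hR2 : R ^ 2 = σ ^ 2 / d * W := by
    rw [hR, mul_pow, div_pow, Real.sq_sqrt hd0.le, Real.sq_sqrt hW0]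
  have hq : (m0 - m1) ⬝ᵥ (ν ^ 2 • A⁻¹)⁻¹ *ᵥ (m0 - m1) ≤ R ^ 2 := by
    rw [hSi, smul_mulVec, dotProduct_smul, smul_eq_mul, hR2]
    have h1 : (ν ^ 2)⁻¹ = σ ^ 2 / d * c := by rw [hc]; field_simp
    rw [h1, mul_assoc]
    exact mul_le_mul_of_nonneg_left hl (by positivity)
  have hgoal : σ / (2 * Real.sqrt d) * Real.sqrt W = R / 2 := by rw [hR]; ring
  rw [hgoal]
  refine le_of_forall_pos_le_add fun e he => ?_
  have := dTV_mvNormal_le_s14 _ hSp m0 m1 (R + 2 * e) (by linarith) (hq.trans (by gcongr; linarith))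
  linarith

end ACSS
end
end

section
/- Let Z ∈ ℝ^{n×d}, X ∈ ℝⁿ, W ∈ ℝ^d, ν > 0, σ ≥ 0, λ_ridge ≥ 0, λ > 0 and θ0 ∈ ℝ^d, and let θ̂ be any minimizer over ℝ^d of θ ↦ (1/(2ν²))‖X − Zθ‖² + σθᵀW + (λ_ridge/2)‖θ‖² + λ‖θ‖₁. Write Δ = θ̂ − θ0, v = X − Zθ0, and S = S(θ0) = {j : (θ0)_j ≠ 0}. If λ ≥ 2‖ν^{-2}Zᵀv − σW − λ_ridge·θ0‖_∞, then (1/2)·Δᵀ(ν^{-2}ZᵀZ + λ_ridge·I_d)Δ ≤ (3/2)λ‖Δ_S‖₁ − (1/2)λ‖Δ_{S^c}‖₁, where Δ_S and Δ_{S^c} denote the restrictions of Δ to the coordinates in S and in its complement. (Basic inequality for the perturbed elastic-net/lasso estimator, proved in the appendix when verifying Assumption 2 for sparse regression.) -/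
open Matrix
open scoped BigOperators

noncomputable section

namespace ACSS

/-- **Basic inequality for the perturbed elastic-net/lasso estimator.**
Let `θ̂` minimize `θ ↦ (1/(2ν²))‖X − Zθ‖² + σθᵀW + (λ_ridge/2)‖θ‖² + λ‖θ‖₁` over `ℝ^d`,
write `Δ = θ̂ − θ0`, `v = X − Zθ0` and `S = {j : (θ0)_j ≠ 0}`.  If
`λ ≥ 2‖ν⁻²Zᵀv − σW − λ_ridge θ0‖_∞`, then
`(1/2)Δᵀ(ν⁻²ZᵀZ + λ_ridge I)Δ ≤ (3/2)λ‖Δ_S‖₁ − (1/2)λ‖Δ_{Sᶜ}‖₁`. -/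
theorem lasso_basic_inequality
    {n d : ℕ} (Z : Matrix (Fin n) (Fin d) ℝ) (X : Fin n → ℝ) (W : Fin d → ℝ)
    (ν σ lamRidge lam : ℝ) (hν : 0 < ν) (hσ : 0 ≤ σ) (hridge : 0 ≤ lamRidge)
    (hlam : 0 < lam)
    (θ0 θh : Fin d → ℝ)
    (hmin : ∀ θ : Fin d → ℝ,
      (∑ i, (X i - Z.mulVec θh i) ^ 2) / (2 * ν ^ 2) + σ * (θh ⬝ᵥ W) +
          lamRidge / 2 * ∑ j, θh j ^ 2 + lam * ∑ j, |θh j| ≤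
        (∑ i, (X i - Z.mulVec θ i) ^ 2) / (2 * ν ^ 2) + σ * (θ ⬝ᵥ W) +
          lamRidge / 2 * ∑ j, θ j ^ 2 + lam * ∑ j, |θ j|)
    (hpen : ∀ j, 2 * |((ν ^ 2)⁻¹ • Zᵀ.mulVec (X - Z.mulVec θ0) - σ • W
      - lamRidge • θ0) j| ≤ lam) :
    1 / 2 * ((θh - θ0) ⬝ᵥ
        (((ν ^ 2)⁻¹ • (Zᵀ * Z) + lamRidge • (1 : Matrix (Fin d) (Fin d) ℝ)).mulVec
          (θh - θ0))) ≤
      3 / 2 * lam * ∑ j ∈ Finset.univ.filter (fun j => θ0 j ≠ 0), |(θh - θ0) j| -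
        1 / 2 * lam * ∑ j ∈ Finset.univ.filter (fun j => θ0 j = 0), |(θh - θ0) j| := by
  obtain ⟨D, rfl⟩ : ∃ D, θh = θ0 + D := ⟨θh - θ0, by simp⟩
  have h := hmin θ0
  clear hmin
  rw [add_sub_cancel_left]
  set v : Fin n → ℝ := X - Z.mulVec θ0 with hv
  set g : Fin d → ℝ := (ν ^ 2)⁻¹ • Zᵀ.mulVec v - σ • W - lamRidge • θ0 with hg
  have hq : D ⬝ᵥ (((ν ^ 2)⁻¹ • (Zᵀ * Z) + lamRidge • (1 : Matrix (Fin d) (Fin d) ℝ)).mulVec D)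
      = (ν ^ 2)⁻¹ * (Z.mulVec D ⬝ᵥ Z.mulVec D) + lamRidge * (D ⬝ᵥ D) := by
    rw [Matrix.add_mulVec, Matrix.smul_mulVec, Matrix.smul_mulVec, Matrix.one_mulVec,
      dotProduct_add, dotProduct_smul, dotProduct_smul, ← Matrix.mulVec_mulVec,
      Matrix.dotProduct_mulVec D, Matrix.vecMul_transpose]
    simp
  have hgD : g ⬝ᵥ D = (ν ^ 2)⁻¹ * (v ⬝ᵥ Z.mulVec D) - σ * (D ⬝ᵥ W) - lamRidge * (θ0 ⬝ᵥ D) := by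
    rw [hg, sub_dotProduct, sub_dotProduct, smul_dotProduct, smul_dotProduct, smul_dotProduct,
      Matrix.mulVec_transpose, ← Matrix.dotProduct_mulVec, dotProduct_comm W D]
    simp
  have h1 : ∑ i, (X i - Z.mulVec (θ0 + D) i) ^ 2
      = v ⬝ᵥ v - 2 * (v ⬝ᵥ Z.mulVec D) + Z.mulVec D ⬝ᵥ Z.mulVec D := by
    simp only [dotProduct, Finset.mul_sum, ← Finset.sum_sub_distrib, ← Finset.sum_add_distrib]
    refine Finset.sum_congr rfl fun i _ => ?_
    rw [Matrix.mulVec_add, hv]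
    simp only [Pi.add_apply, Pi.sub_apply]
    ring
  have h2 : ∑ i, (X i - Z.mulVec θ0 i) ^ 2 = v ⬝ᵥ v := by
    simp only [dotProduct]
    refine Finset.sum_congr rfl fun i _ => ?_
    rw [hv]
    simp only [Pi.sub_apply]
    ring
  have h3 : ∑ j, (θ0 + D) j ^ 2 = ∑ j, θ0 j ^ 2 + 2 * (θ0 ⬝ᵥ D) + D ⬝ᵥ D := by
    simp only [dotProduct, Finset.mul_sum, ← Finset.sum_add_distrib]
    refine Finset.sum_congr rfl fun i _ => ?_
    simp only [Pi.add_apply]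
    ring
  rw [h1, h2, h3, add_dotProduct] at h
  have e : ∀ a : ℝ, a / (2 * ν ^ 2) = 1 / 2 * ((ν ^ 2)⁻¹ * a) := by
    intro a
    rw [div_eq_mul_inv, mul_inv]
    ring
  rw [e, e] at h
  have hb : 1 / 2 * ((ν ^ 2)⁻¹ * (Z.mulVec D ⬝ᵥ Z.mulVec D) + lamRidge * (D ⬝ᵥ D))
      ≤ g ⬝ᵥ D + lam * (∑ j, |θ0 j|) - lam * ∑ j, |(θ0 + D) j| := by
    rw [hgD]
    linarith
  rw [hq]
  refine hb.trans ?_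
  rw [Finset.sum_filter, Finset.sum_filter]
  simp only [dotProduct, Finset.mul_sum, ← Finset.sum_sub_distrib, ← Finset.sum_add_distrib]
  refine Finset.sum_le_sum fun j _ => ?_
  have hgj : g j * D j ≤ lam / 2 * |D j| := by
    refine (le_abs_self _).trans ?_
    rw [abs_mul]
    have := hpen j
    exact mul_le_mul_of_nonneg_right (by linarith) (abs_nonneg _)
  by_cases hj : θ0 j = 0
  · simp only [hj, Pi.add_apply]
    simp
    linarith
  · have ht : |θ0 j| ≤ |θ0 j + D j| + |D j| := by
      have := abs_sub (θ0 j + D j) (D j)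
      simpa using this
    have := mul_le_mul_of_nonneg_left ht hlam.le
    simp only [hj, Pi.add_apply]
    simp [hj]
    linarith


end ACSS
end
end
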